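/- Assume a, c > 0 and b² = 27ac, and let K = 4. Let φ : 𝒬 → ℝ be smooth, nonnegative, supported in the unit ball of 𝒬, with ∫_𝒬 φ = 1, and set φ_ε(q) := ε^{−5K} φ(ε^{−K} q), d^F_ε := φ_ε * d^F, and F_ε(q) := F(q) + ε^{K−1}. Then for every c₀ > 0 there exists ε₀ > 0 such that for all ε ∈ (0, ε₀) and all q ∈ 𝒬 with |q| ≤ c₀, one has |∇_q d^F_ε(q)| ≤ √(2 F_ε(q)). -/

import Mathlib

open Matrix MeasureTheory
open scoped RealInnerProductSpace

noncomputable section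

attribute [local instance] Matrix.frobeniusNormedAddCommGroup Matrix.frobeniusNormedSpace

/-- The configuration space `𝒬`: symmetric traceless `3 × 3` real matrices. -/
def isQ (Q : Matrix (Fin 3) (Fin 3) ℝ) : Prop := Q.IsSymm ∧ Q.trace = 0

/-- The Landau--De Gennes bulk energy density. -/
def Fbulk (a b c : ℝ) (Q : Matrix (Fin 3) (Fin 3) ℝ) : ℝ :=
  a / 2 * (Q * Q).trace - b / 3 * (Q * Q * Q).trace + c / 4 * ((Q * Q).trace) ^ 2

/-- The Frobenius norm `|Q| = √(tr(Qᵀ Q))`. -/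
def fnorm (Q : Matrix (Fin 3) (Fin 3) ℝ) : ℝ := Real.sqrt ((Qᵀ * Q).trace)

/-- The uniaxial matrix `s (u ⊗ u − (1/3) I₃)`. -/
def uniax (s : ℝ) (u : Fin 3 → ℝ) : Matrix (Fin 3) (Fin 3) ℝ :=
  s • (vecMulVec u u - (1 / 3 : ℝ) • (1 : Matrix (Fin 3) (Fin 3) ℝ))

/-- The nematic manifold `𝒩 = {s₊ (u ⊗ u − I₃/3) : u ∈ 𝕊²}` with `s₊ = √(3a/c)`. -/
def NSet (a c : ℝ) : Set (Matrix (Fin 3) (Fin 3) ℝ) :=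
  {Q | ∃ u : Fin 3 → ℝ, u ⬝ᵥ u = 1 ∧ Q = uniax (Real.sqrt (3 * a / c)) u}

/-- Admissible paths for the quasi-distance: Lipschitz paths `γ : [0,1] → 𝒬` starting
on `𝒩` and ending at `q`. -/
def admissible (a c : ℝ) (q : Matrix (Fin 3) (Fin 3) ℝ)
    (γ : ℝ → Matrix (Fin 3) (Fin 3) ℝ) : Prop :=
  (∃ K : NNReal, LipschitzOnWith K γ (Set.Icc 0 1)) ∧
    (∀ t ∈ Set.Icc (0 : ℝ) 1, isQ (γ t)) ∧ γ 0 ∈ NSet a c ∧ γ 1 = q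

/-- The quasi-distance `d^F(q) = inf ∫₀¹ √(2F(γ)) |γ'| dt` over admissible paths. -/
def dF (a b c : ℝ) (q : Matrix (Fin 3) (Fin 3) ℝ) : ℝ :=
  sInf {e : ℝ | ∃ γ : ℝ → Matrix (Fin 3) (Fin 3) ℝ, admissible a c q γ ∧
    e = ∫ t in (0 : ℝ)..1, Real.sqrt (2 * Fbulk a b c (γ t)) * fnorm (deriv γ t)}

open Set Filter Topology

theorem fnorm_eq_norm (Q : Matrix (Fin 3) (Fin 3) ℝ) : fnorm Q = ‖Q‖ := by
  rw [fnorm, Matrix.frobenius_norm_def, Real.sqrt_eq_rpow]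
  congr 1
  simp only [Matrix.trace, Matrix.diag_apply, Matrix.mul_apply, Matrix.transpose_apply,
    Real.norm_eq_abs, Real.rpow_two, sq_abs]
  rw [Finset.sum_comm]
  simp only [sq]

theorem isQ_add_smul {p q : Matrix (Fin 3) (Fin 3) ℝ} (hp : isQ p) (hq : isQ q) (s : ℝ) :
    isQ (p + s • (q - p)) := by
  refine ⟨hp.1.add ((hq.1.sub hp.1).smul s), ?_⟩
  simp [hp.2, hq.2]

theorem isQ_uniax (s : ℝ) {u : Fin 3 → ℝ} (hu : u ⬝ᵥ u = 1) : isQ (uniax s u) := by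
  constructor
  · unfold uniax Matrix.IsSymm
    simp [Matrix.transpose_vecMulVec]
  · simp [uniax, Matrix.trace_vecMulVec, hu]

theorem contDiff_Fbulk (a b c : ℝ) : ContDiff ℝ 1 (Fbulk a b c) := by
  have hm : ∀ i j, ContDiff ℝ 1 fun Q : Matrix (Fin 3) (Fin 3) ℝ => Q i j := fun i j =>
    (Matrix.entryLinearMap ℝ ℝ i j).toContinuousLinearMap.contDiff
  unfold Fbulk
  simp only [Matrix.trace, Matrix.diag_apply, Matrix.mul_apply]
  have h₂ : ContDiff ℝ 1 fun Q : Matrix (Fin 3) (Fin 3) ℝ => ∑ i, ∑ j, Q i j * Q j i :=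
    ContDiff.sum fun i _ => ContDiff.sum fun j _ => (hm i j).mul (hm j i)
  have h₃ : ContDiff ℝ 1 fun Q : Matrix (Fin 3) (Fin 3) ℝ =>
      ∑ i, ∑ j, (∑ k, Q i k * Q k j) * Q j i :=
    ContDiff.sum fun i _ => ContDiff.sum fun j _ =>
      (ContDiff.sum fun k _ => (hm i k).mul (hm k j)).mul (hm j i)
  exact ((contDiff_const.mul h₂).sub (contDiff_const.mul h₃)).add (contDiff_const.mul (h₂.pow 2))

/-- The energy density of a path. -/
def pathDensity (a b c : ℝ) (γ : ℝ → Matrix (Fin 3) (Fin 3) ℝ) (t : ℝ) : ℝ :=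
  Real.sqrt (2 * Fbulk a b c (γ t)) * fnorm (deriv γ t)

theorem pathDensity_nonneg (a b c : ℝ) (γ : ℝ → Matrix (Fin 3) (Fin 3) ℝ) (t : ℝ) :
    0 ≤ pathDensity a b c γ t :=
  mul_nonneg (Real.sqrt_nonneg _) (Real.sqrt_nonneg _)

theorem intervalIntegrable_pathDensity (a b c : ℝ) {γ : ℝ → Matrix (Fin 3) (Fin 3) ℝ} {K : NNReal}
    (hγ : LipschitzOnWith K γ (Icc 0 1)) :
    IntervalIntegrable (pathDensity a b c γ) volume 0 1 := by
  have hcont : ContinuousOn (fun t => Real.sqrt (2 * Fbulk a b c (γ t))) (uIcc 0 1) := by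
    rw [uIcc_of_le zero_le_one]
    exact (((contDiff_Fbulk a b c).continuous.comp_continuousOn hγ.continuousOn).const_smul
      (2 : ℝ)).sqrt
  have hderiv : IntervalIntegrable (fun t => fnorm (deriv γ t)) volume 0 1 := by
    simp only [fnorm_eq_norm]
    rw [intervalIntegrable_iff_integrableOn_Ioo_of_le zero_le_one]
    refine Measure.integrableOn_of_bounded (M := K) (by simp)
      (stronglyMeasurable_deriv γ).norm.aestronglyMeasurable ?_
    filter_upwards [ae_restrict_mem measurableSet_Ioo] with t ht
    rw [norm_norm]
    exact norm_deriv_le_of_lipschitzOn (Icc_mem_nhds ht.1 ht.2) hγ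
  exact hderiv.continuousOn_mul hcont

theorem exists_admissible_extension {a b c : ℝ} {q r : Matrix (Fin 3) (Fin 3) ℝ}
    {γ : ℝ → Matrix (Fin 3) (Fin 3) ℝ} (hγ : admissible a c q γ) (hr : isQ r) {M : ℝ}
    (hM : ∀ s ∈ Icc (0 : ℝ) 1, Real.sqrt (2 * Fbulk a b c (q + s • (r - q))) ≤ M) :
    ∃ η, admissible a c r η ∧
      ∫ t in (0 : ℝ)..1, pathDensity a b c η t ≤
        (∫ t in (0 : ℝ)..1, pathDensity a b c γ t) + M * fnorm (r - q) := by
  obtain ⟨⟨K, hK⟩, hQ, h0, h1⟩ := hγ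
  have hq : isQ q := h1 ▸ hQ 1 (by simp)
  let η : ℝ → Matrix (Fin 3) (Fin 3) ℝ := fun t => γ (min (2 * t) 1) + (max (2 * t) 1 - 1) • (r - q)
  have hη₁ : ∀ t ≤ 1 / 2, η t = γ (2 * t) := fun t ht => by
    simp only [η]
    rw [min_eq_left (by linarith), max_eq_right (by linarith)]
    simp
  have hη₂ : ∀ t, 1 / 2 ≤ t → η t = q + (2 * t - 1) • (r - q) := fun t ht => by
    simp only [η]
    rw [min_eq_right (by linarith), max_eq_left (by linarith), h1]
  have hlip : ∃ K, LipschitzOnWith K η (Icc 0 1) := by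
    refine ⟨K * 2 + ‖r - q‖₊ * 2, LipschitzOnWith.of_dist_le_mul fun s hs t ht => ?_⟩
    have hmin : |min (2 * s) 1 - min (2 * t) 1| ≤ 2 * |s - t| := by
      calc _ ≤ |2 * s - 2 * t| := abs_inf_sub_inf_le_abs _ _ _
        _ = 2 * |s - t| := by rw [← mul_sub, abs_mul, abs_two]
    have hmax : |max (2 * s) 1 - max (2 * t) 1| ≤ 2 * |s - t| := by
      calc _ ≤ |2 * s - 2 * t| := abs_max_sub_max_le_abs _ _ _
        _ = 2 * |s - t| := by rw [← mul_sub, abs_mul, abs_two]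
    have hmem : ∀ u ∈ Icc (0 : ℝ) 1, min (2 * u) 1 ∈ Icc (0 : ℝ) 1 := fun u hu =>
      ⟨le_min (by linarith [hu.1]) zero_le_one, min_le_right _ _⟩
    have hd := hK.dist_le_mul _ (hmem s hs) _ (hmem t ht)
    rw [Real.dist_eq] at hd
    refine (dist_add_add_le _ _ _ _).trans ?_
    have hv : dist ((max (2 * s) 1 - 1) • (r - q)) ((max (2 * t) 1 - 1) • (r - q)) ≤
        (2 * |s - t|) * ‖r - q‖ := by
      rw [dist_eq_norm, ← sub_smul, norm_smul, sub_sub_sub_cancel_right, Real.norm_eq_abs]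
      gcongr
    have hd' := hd.trans (mul_le_mul_of_nonneg_left hmin K.coe_nonneg)
    rw [Real.dist_eq]
    push_cast
    linarith
  refine ⟨η, ⟨hlip, fun t ht => ?_, ?_, ?_⟩, ?_⟩
  · rcases le_total t (1 / 2) with h | h
    · rw [hη₁ t h]
      exact hQ _ ⟨by linarith [ht.1], by linarith⟩
    · rw [hη₂ t h]
      exact isQ_add_smul hq hr _
  · rwa [hη₁ 0 (by norm_num), mul_zero]
  · rw [hη₂ 1 (by norm_num)]
    norm_num
  · obtain ⟨K', hK'⟩ := hlip
    have hint := intervalIntegrable_pathDensity a b c hK'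
    have hsub : ∀ {s t : ℝ}, s ∈ Icc (0 : ℝ) 1 → t ∈ Icc (0 : ℝ) 1 → uIcc s t ⊆ uIcc 0 1 :=
      fun hs ht => by rw [uIcc_of_le zero_le_one]; exact uIcc_subset_Icc hs ht
    have hhalf : (1 / 2 : ℝ) ∈ Icc (0 : ℝ) 1 := by norm_num
    have hint₁ := hint.mono_set (hsub (left_mem_Icc.2 zero_le_one) hhalf)
    have hint₂ := hint.mono_set (hsub hhalf (right_mem_Icc.2 zero_le_one))
    have hleft : ∫ t in (0 : ℝ)..(1 / 2), pathDensity a b c η t =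
        ∫ t in (0 : ℝ)..1, pathDensity a b c γ t := by
      have hscale : ∫ t in (0 : ℝ)..(1 / 2), pathDensity a b c η t =
          ∫ t in (0 : ℝ)..(1 / 2), 2 * pathDensity a b c γ (2 * t) := by
        refine intervalIntegral.integral_congr_Ioo_of_le (by norm_num) fun t ht => ?_
        have hd : deriv η t = (2 : ℝ) • deriv γ (2 * t) := by
          have hev : η =ᶠ[𝓝 t] fun s => γ (2 * s) := by
            filter_upwards [Iio_mem_nhds ht.2] with s hs using hη₁ s hs.le
          exact hev.deriv_eq.trans (deriv_comp_mul_left 2 γ t)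
        simp only [pathDensity, hd, fnorm_eq_norm, norm_smul, hη₁ t ht.2.le]
        norm_num
        ring
      rw [hscale, intervalIntegral.integral_const_mul, ← smul_eq_mul,
        intervalIntegral.smul_integral_comp_mul_left]
      norm_num
    have hright : ∫ t in (1 / 2 : ℝ)..1, pathDensity a b c η t ≤ M * fnorm (r - q) := by
      have hbound : ∀ t ∈ Ioo (1 / 2 : ℝ) 1, pathDensity a b c η t ≤ M * (2 * fnorm (r - q)) := by
        intro t ht
        have hd : deriv η t = (2 : ℝ) • (r - q) := by
          have hev : η =ᶠ[𝓝 t] fun s => q + (2 * s - 1) • (r - q) := by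
            filter_upwards [Ioi_mem_nhds ht.1] with s hs using hη₂ s (le_of_lt hs)
          have h := (((((hasDerivAt_id t).const_mul 2).sub_const 1).smul_const (r - q)).const_add q)
          exact hev.deriv_eq.trans (h.deriv.trans (by rw [mul_one]))
        have hs := hM (2 * t - 1) ⟨by linarith [ht.1], by linarith [ht.2]⟩
        simp only [pathDensity, hd, hη₂ t ht.1.le, fnorm_eq_norm, norm_smul, Real.norm_ofNat]
        gcongr
      calc _ ≤ ∫ _ in (1 / 2 : ℝ)..1, M * (2 * fnorm (r - q)) :=
            intervalIntegral.integral_mono_on_of_le_Ioo (by norm_num) hint₂ (by simp) hbound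
        _ = M * fnorm (r - q) := by
            rw [intervalIntegral.integral_const, smul_eq_mul]
            ring
    rw [← intervalIntegral.integral_add_adjacent_intervals hint₁ hint₂, hleft]
    gcongr

theorem bddBelow_energies (a b c : ℝ) (q : Matrix (Fin 3) (Fin 3) ℝ) :
    BddBelow {e : ℝ | ∃ γ : ℝ → Matrix (Fin 3) (Fin 3) ℝ, admissible a c q γ ∧
      e = ∫ t in (0 : ℝ)..1, Real.sqrt (2 * Fbulk a b c (γ t)) * fnorm (deriv γ t)} := by
  refine ⟨0, ?_⟩
  rintro _ ⟨γ, -, rfl⟩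
  exact intervalIntegral.integral_nonneg zero_le_one fun t _ => pathDensity_nonneg a b c γ t

theorem exists_admissible (a c : ℝ) {q : Matrix (Fin 3) (Fin 3) ℝ} (hq : isQ q) :
    ∃ γ, admissible a c q γ := by
  have hu : (Pi.single 0 1 : Fin 3 → ℝ) ⬝ᵥ Pi.single 0 1 = 1 := by simp
  have hn := isQ_uniax (Real.sqrt (3 * a / c)) hu
  set n := uniax (Real.sqrt (3 * a / c)) (Pi.single 0 1)
  refine ⟨fun t => n + t • (q - n), ⟨‖q - n‖₊, ?_⟩, fun t _ => isQ_add_smul hn hq t,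
    ⟨_, hu, by simp [n]⟩, by simp⟩
  refine LipschitzOnWith.of_dist_le_mul fun s _ t _ => ?_
  rw [dist_add_left, dist_eq_norm, ← sub_smul, norm_smul, coe_nnnorm, dist_eq_norm, mul_comm]

theorem dF_le_add {a b c : ℝ} {q r : Matrix (Fin 3) (Fin 3) ℝ} (hq : isQ q) (hr : isQ r) {M : ℝ}
    (hM : ∀ s ∈ Icc (0 : ℝ) 1, Real.sqrt (2 * Fbulk a b c (q + s • (r - q))) ≤ M) :
    dF a b c r ≤ dF a b c q + M * fnorm (r - q) := by
  rw [← sub_le_iff_le_add]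
  obtain ⟨γ₀, hγ₀⟩ := exists_admissible a c hq
  refine le_csInf ⟨_, γ₀, hγ₀, rfl⟩ ?_
  rintro _ ⟨γ, hγ, rfl⟩
  obtain ⟨η, hη, hle⟩ := exists_admissible_extension hγ hr hM
  rw [sub_le_iff_le_add]
  exact (csInf_le (bddBelow_energies a b c r) ⟨η, hη, rfl⟩).trans hle

/-- A pointwise bound on `√(2F)` over a convex set is a Lipschitz constant for `d^F` there. -/
theorem abs_dF_sub_le {E : Type*} [NormedAddCommGroup E] [NormedSpace ℝ E] {a b c : ℝ}
    (e : E →ₗ[ℝ] Matrix (Fin 3) (Fin 3) ℝ) (he : ∀ x, isQ (e x)) (hnorm : ∀ x, fnorm (e x) = ‖x‖)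
    {S : Set E} (hS : Convex ℝ S) {M : ℝ} (hM : ∀ x ∈ S, Real.sqrt (2 * Fbulk a b c (e x)) ≤ M)
    {x y : E} (hx : x ∈ S) (hy : y ∈ S) :
    |dF a b c (e x) - dF a b c (e y)| ≤ M * ‖x - y‖ := by
  have key : ∀ {x y : E}, x ∈ S → y ∈ S → dF a b c (e x) - dF a b c (e y) ≤ M * ‖x - y‖ := by
    intro x y hx hy
    rw [sub_le_iff_le_add', ← hnorm, map_sub]
    refine dF_le_add (he y) (he x) fun s hs => ?_
    rw [← map_sub, ← map_smul, ← map_add]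
    exact hM _ (hS.add_smul_sub_mem hy hx hs)
  rw [abs_le]
  have := key hy hx
  rw [norm_sub_rev] at this
  exact ⟨by linarith, key hx hy⟩

theorem continuous_dF_comp {E : Type*} [NormedAddCommGroup E] [NormedSpace ℝ E]
    [FiniteDimensional ℝ E] (a b c : ℝ)
    (e : E →ₗ[ℝ] Matrix (Fin 3) (Fin 3) ℝ) (he : ∀ x, isQ (e x)) (hnorm : ∀ x, fnorm (e x) = ‖x‖) :
    Continuous fun x => dF a b c (e x) := by
  have : ProperSpace E := FiniteDimensional.proper_real E
  rw [continuous_iff_continuousAt]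
  intro x
  have hF : Continuous fun x => Real.sqrt (2 * Fbulk a b c (e x)) :=
    (continuous_const.mul ((contDiff_Fbulk a b c).continuous.comp
      e.continuous_of_finiteDimensional)).sqrt
  obtain ⟨M, hM⟩ := (isCompact_closedBall x 1).bddAbove_image hF.continuousOn
  have hM' : ∀ y ∈ Metric.closedBall x 1, Real.sqrt (2 * Fbulk a b c (e y)) ≤ M := fun y hy =>
    hM (mem_image_of_mem _ hy)
  have hM0 : 0 ≤ M := (Real.sqrt_nonneg _).trans (hM' x (by simp))
  have hlip : LipschitzOnWith M.toNNReal (fun x => dF a b c (e x)) (Metric.closedBall x 1) :=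
    LipschitzOnWith.of_dist_le_mul fun y hy z hz => by
      rw [Real.dist_eq, dist_eq_norm, Real.coe_toNNReal _ hM0]
      exact abs_dF_sub_le e he hnorm (convex_closedBall x 1) hM' hy hz
  exact hlip.continuousOn.continuousAt (Metric.closedBall_mem_nhds x one_pos)

theorem norm_gradient_mollification_le {E : Type*} [NormedAddCommGroup E] [InnerProductSpace ℝ E]
    [CompleteSpace E] [MeasurableSpace E] (μ : Measure E) {ρ f : E → ℝ} (hρ : ∀ p, 0 ≤ ρ p)
    (hρ_int : ∫ p, ρ p ∂μ = 1) {R δ M : ℝ} (hδ : 0 < δ) (hM : 0 ≤ M)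
    (hρ_supp : ∀ p, R < ‖p‖ → ρ p = 0)
    (hint : ∀ y, Integrable (fun p => ρ p * f (y - p)) μ) {x : E}
    (hf : ∀ y ∈ Metric.closedBall x (R + δ), ∀ z ∈ Metric.closedBall x (R + δ),
      |f y - f z| ≤ M * ‖y - z‖) :
    ‖gradient (fun y => ∫ p, ρ p * f (y - p) ∂μ) x‖ ≤ M := by
  rw [gradient, LinearIsometryEquiv.norm_map]
  refine norm_fderiv_le_of_lip' ℝ hM ?_
  filter_upwards [Metric.closedBall_mem_nhds x hδ] with y hy
  rw [mem_closedBall_iff_norm] at hy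
  have hρi : Integrable ρ μ := by
    by_contra h
    simp [integral_undef h] at hρ_int
  rw [← integral_sub (hint y) (hint x)]
  calc _ ≤ ∫ p, ρ p * (M * ‖y - x‖) ∂μ := by
        refine norm_integral_le_of_norm_le (hρi.mul_const _) (.of_forall fun p => ?_)
        rw [← mul_sub, norm_mul, Real.norm_of_nonneg (hρ p), Real.norm_eq_abs]
        rcases lt_or_ge R ‖p‖ with hp | hp
        · simp [hρ_supp p hp]
        · refine mul_le_mul_of_nonneg_left ?_ (hρ p)
          have := hf (y - p) ?_ (x - p) ?_
          · rwa [sub_sub_sub_cancel_right] at this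
          · rw [mem_closedBall_iff_norm]
            calc ‖y - p - x‖ = ‖(y - x) - p‖ := by congr 1; abel
              _ ≤ ‖y - x‖ + ‖p‖ := norm_sub_le _ _
              _ ≤ R + δ := by linarith
          · rw [mem_closedBall_iff_norm, sub_sub_cancel_left, norm_neg]
            linarith
    _ = M * ‖y - x‖ := by rw [integral_mul_const, hρ_int, one_mul]

/-- with `K = 4` and mollifiers `φ_ε(q) = ε^{−5K} φ(ε^{−K} q)` built from a
smooth nonnegative `φ` supported in the unit ball of `𝒬` with `∫ φ = 1`, the mollified
quasi-distance `d^F_ε = φ_ε * d^F` (computed through an isometric parametrization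
`e : ℝ⁵ ≅ 𝒬`) satisfies, for every `c₀ > 0` and all sufficiently small `ε`,
`|∇ d^F_ε(q)| ≤ √(2 F_ε(q))` on `{|q| ≤ c₀}`, where `F_ε = F + ε^{K−1}`. -/
theorem stmt14 (a b c : ℝ) (ha : 0 < a) (hb : 0 < b) (hc : 0 < c)
    (habc : b ^ 2 = 27 * a * c)
    (e : EuclideanSpace ℝ (Fin 5) →ₗ[ℝ] Matrix (Fin 3) (Fin 3) ℝ)
    (he_inner : ∀ x y : EuclideanSpace ℝ (Fin 5), ((e x)ᵀ * e y).trace = ⟪x, y⟫)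
    (he_range : Set.range e = {p | isQ p})
    (φ : Matrix (Fin 3) (Fin 3) ℝ → ℝ)
    (hφ_smooth : ContDiff ℝ (⊤ : ℕ∞) fun x : EuclideanSpace ℝ (Fin 5) => φ (e x))
    (hφ_nonneg : ∀ q, 0 ≤ φ q)
    (hφ_supp : ∀ q, isQ q → 1 < fnorm q → φ q = 0)
    (hφ_int : (∫ x : EuclideanSpace ℝ (Fin 5), φ (e x)) = 1) :
    ∀ c₀ : ℝ, 0 < c₀ → ∃ ε₀ : ℝ, 0 < ε₀ ∧ ∀ ε : ℝ, 0 < ε → ε < ε₀ →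
      ∀ x : EuclideanSpace ℝ (Fin 5), ‖x‖ ≤ c₀ →
        ‖gradient (fun y : EuclideanSpace ℝ (Fin 5) =>
            ∫ p : EuclideanSpace ℝ (Fin 5),
              (ε ^ (4 : ℕ))⁻¹ ^ (5 : ℕ) * φ ((ε ^ (4 : ℕ))⁻¹ • e p) * dF a b c (e (y - p))) x‖
          ≤ Real.sqrt (2 * (Fbulk a b c (e x) + ε ^ (3 : ℕ))) := by
  have he : ∀ x, isQ (e x) := fun x => he_range.subset (mem_range_self x)
  have hnorm : ∀ x, fnorm (e x) = ‖x‖ := fun x => by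
    rw [fnorm, he_inner, real_inner_self_eq_norm_sq, Real.sqrt_sq (norm_nonneg x)]
  intro c₀ hc₀
  have hFdiff : ContDiff ℝ 1 fun x => Fbulk a b c (e x) :=
    (contDiff_Fbulk a b c).comp e.toContinuousLinearMap.contDiff
  obtain ⟨L, hL⟩ := hFdiff.locallyLipschitz.locallyLipschitzOn.exists_lipschitzOnWith_of_compact
    (isCompact_closedBall (0 : EuclideanSpace ℝ (Fin 5)) (c₀ + 2))
  refine ⟨1 / (2 * L + 1), by positivity, fun ε hε hε₀ x hx => ?_⟩
  have hεL : ε * (2 * L + 1) < 1 := by rwa [lt_div_iff₀ (by positivity)] at hε₀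
  have hLε : 0 ≤ ε * L := by positivity
  have hε1 : ε < 1 := by nlinarith
  have hε4 : 0 < ε ^ 4 := by positivity
  have hε41 : ε ^ 4 ≤ 1 := pow_le_one₀ hε.le hε1.le
  have hsupp : ∀ p, ε ^ 4 < ‖p‖ → φ ((ε ^ 4)⁻¹ • e p) = 0 := fun p hp => by
    rw [← map_smul]
    refine hφ_supp _ (he _) ?_
    rw [hnorm, norm_smul, Real.norm_of_nonneg (by positivity), inv_mul_eq_div, one_lt_div hε4]
    exact hp
  have hcont : Continuous fun p => (ε ^ 4)⁻¹ ^ 5 * φ ((ε ^ 4)⁻¹ • e p) := by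
    simp only [← map_smul]
    exact continuous_const.mul (hφ_smooth.continuous.comp (continuous_const_smul _))
  have hdF := continuous_dF_comp a b c e he hnorm
  refine norm_gradient_mollification_le volume (R := ε ^ 4) (δ := ε ^ 4)
    (ρ := fun p => (ε ^ 4)⁻¹ ^ 5 * φ ((ε ^ 4)⁻¹ • e p)) (f := fun y => dF a b c (e y))
    (fun p => mul_nonneg (by positivity) (hφ_nonneg _)) ?_ hε4 (Real.sqrt_nonneg _)
    (fun p hp => by simp [hsupp p hp]) (fun y => ?_) fun y hy z hz => ?_
  · simp only [← map_smul]
    rw [integral_const_mul, Measure.integral_comp_smul volume (fun p => φ (e p)), hφ_int,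
      finrank_euclideanSpace_fin, abs_of_pos (by positivity), smul_eq_mul, mul_one, ← mul_inv_cancel₀]
    positivity
  · refine Continuous.integrable_of_hasCompactSupport
      (hcont.mul (hdF.comp (continuous_const.sub continuous_id))) ?_
    refine HasCompactSupport.intro (isCompact_closedBall 0 (ε ^ 4)) fun p hp => ?_
    rw [mem_closedBall_zero_iff, not_le] at hp
    simp [hsupp p hp]
  · refine abs_dF_sub_le e he hnorm (convex_closedBall x (ε ^ 4 + ε ^ 4)) (fun w hw => ?_) hy hz
    have hx' : x ∈ Metric.closedBall (0 : EuclideanSpace ℝ (Fin 5)) (c₀ + 2) := by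
      rw [mem_closedBall_zero_iff]
      linarith
    have hwx : ‖w - x‖ ≤ ε ^ 4 + ε ^ 4 := mem_closedBall_iff_norm.1 hw
    have hw' : w ∈ Metric.closedBall (0 : EuclideanSpace ℝ (Fin 5)) (c₀ + 2) := by
      rw [mem_closedBall_zero_iff]
      linarith [norm_le_norm_add_norm_sub' w x]
    have hLip := hL.dist_le_mul w hw' x hx'
    rw [Real.dist_eq, dist_eq_norm] at hLip
    have hbound : L * ‖w - x‖ ≤ ε ^ 3 := by
      calc L * ‖w - x‖ ≤ L * (ε ^ 4 + ε ^ 4) := by gcongr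
        _ = ε ^ 3 * (2 * (ε * L)) := by ring
        _ ≤ ε ^ 3 * 1 := by gcongr; linarith
        _ = ε ^ 3 := mul_one _
    gcongr
    linarith [le_abs_self (Fbulk a b c (e w) - Fbulk a b c (e x))]
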